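/- arXiv:math/0302260 — 4 statements merged into one kernel-verified Lean document; each statement's English description precedes it below -/
import Mathlib

section
/- The torsion subgroup of the quotient of ℤ⁷ by the subgroup generated by the ten vectors v₁,…,v₁₀ is isomorphic to ℤ/2ℤ. -/
/-- The ten columns of the specialisation matrix in Dalawat's computation of the
Chow group of degree-0 zero-cycles of a degree-4 del Pezzo surface over a local field. -/
def dalawatVectors : Fin 10 → (Fin 7 → ℤ) :=
  ![![-2, 1, 0, 2, 0, 0, 0],
    ![-1, 0, 0, 0, 1, 0, 0],
    ![-1, 0, 0, 0, 0, 1, 0],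
    ![-2, 0, 0, 0, 0, 0, 1],
    ![1, 0, 0, -2, 0, 0, 0],
    ![1, -2, 2, 0, 0, 0, 0],
    ![0, -1, 0, 0, 1, 0, 0],
    ![0, -1, 0, 0, 0, 1, 0],
    ![0, -2, 0, 0, 0, 0, 1],
    ![0, 1, -2, 0, 0, 0, 0]]

/-- The map `ℤ⁷ → ℤ × ℤ/2ℤ` whose kernel is the span of the ten vectors. -/
def specialisationMap : (Fin 7 → ℤ) →ₗ[ℤ] ℤ × ZMod 2 :=
  AddMonoidHom.toIntLinearMap
    { toFun := fun x =>
        (2 * x 0 + 2 * x 1 + x 2 + x 3 + 2 * x 4 + 2 * x 5 + 4 * x 6, (x 2 : ZMod 2))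
      map_zero' := by simp
      map_add' := fun x y => by
        ext
        · simp only [Pi.add_apply, Prod.mk_add_mk]
          ring
        · simp }

theorem specialisationMap_apply (x : Fin 7 → ℤ) :
    specialisationMap x =
      (2 * x 0 + 2 * x 1 + x 2 + x 3 + 2 * x 4 + 2 * x 5 + 4 * x 6, (x 2 : ZMod 2)) :=
  rfl

theorem specialisationMap_surjective : Function.Surjective specialisationMap := by
  rintro ⟨a, z⟩
  obtain ⟨b, rfl⟩ := ZMod.intCast_surjective z
  exact ⟨![0, 0, b, a - b, 0, 0, 0], by simp [specialisationMap_apply]⟩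

theorem span_dalawatVectors_eq_ker :
    Submodule.span ℤ (Set.range dalawatVectors) = LinearMap.ker specialisationMap := by
  apply le_antisymm
  · rw [Submodule.span_le]
    rintro _ ⟨i, rfl⟩
    rw [SetLike.mem_coe, LinearMap.mem_ker, specialisationMap_apply]
    fin_cases i <;> decide
  · intro x hx
    rw [LinearMap.mem_ker, specialisationMap_apply, Prod.mk_eq_zero] at hx
    obtain ⟨hsum, hpar⟩ := hx
    obtain ⟨k, hk⟩ := (ZMod.intCast_zmod_eq_zero_iff_dvd (x 2) 2).mp hpar
    rw [Submodule.mem_span_range_iff_exists_fun]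
    refine ⟨![x 1 + k, x 4, x 5, x 6, x 0 + x 4 + x 5 + 2 * x 6 + 2 * (x 1 + k),
      0, 0, 0, 0, -k], ?_⟩
    push_cast at hk
    ext j
    fin_cases j <;> simp [Fin.sum_univ_succ, dalawatVectors] <;> linarith

/-- The quotient of `ℤ⁷` by the span of the ten vectors is `ℤ × ℤ/2ℤ`. -/
noncomputable def quotientSpanEquiv :
    ((Fin 7 → ℤ) ⧸ Submodule.span ℤ (Set.range dalawatVectors)) ≃ₗ[ℤ] ℤ × ZMod 2 :=
  (Submodule.quotEquivOfEq _ _ span_dalawatVectors_eq_ker).trans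
    (specialisationMap.quotKerEquivOfSurjective specialisationMap_surjective)

/-- If `M ≃ ℤ × ℤ/nℤ` with `n ≠ 0`, then the torsion of `M` is `ℤ/nℤ`. -/
theorem nonempty_torsion_equiv_zmod {M : Type*} [AddCommGroup M] {n : ℕ} (hn : n ≠ 0)
    (e : M ≃ₗ[ℤ] ℤ × ZMod n) : Nonempty (Submodule.torsion ℤ M ≃ₗ[ℤ] ZMod n) := by
  refine ⟨LinearEquiv.ofBijective
    (LinearMap.snd ℤ ℤ (ZMod n) ∘ₗ e.toLinearMap ∘ₗ (Submodule.torsion ℤ M).subtype) ⟨?_, ?_⟩⟩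
  · rw [injective_iff_map_eq_zero]
    rintro ⟨m, hm⟩ hsnd
    obtain ⟨a, ha⟩ := (Submodule.mem_torsion_iff m).mp hm
    have hfst : (a : ℤ) * (e m).1 = 0 := by
      have h := congrArg (fun y => (e y).1) ha
      simpa [Submonoid.smul_def] using h
    have hfst' : (e m).1 = 0 :=
      (mul_eq_zero.mp hfst).resolve_left (nonZeroDivisors.coe_ne_zero a)
    exact Subtype.ext (e.map_eq_zero_iff.mp (Prod.ext hfst' hsnd))
  · intro z
    refine ⟨⟨e.symm (0, z), (Submodule.mem_torsion_iff _).mpr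
      ⟨⟨n, mem_nonZeroDivisors_of_ne_zero (Int.natCast_ne_zero.mpr hn)⟩, ?_⟩⟩, by simp⟩
    rw [Submonoid.smul_def, ← map_smul]
    simp

/-- The torsion subgroup of the quotient of `ℤ⁷` by the subgroup generated by the ten
vectors `v₁, …, v₁₀` is isomorphic to `ℤ/2ℤ`. -/
theorem torsion_of_quotient_isomorphic_zmod_two :
    Nonempty
      ((Submodule.torsion ℤ
          ((Fin 7 → ℤ) ⧸ Submodule.span ℤ (Set.range dalawatVectors))) ≃ₗ[ℤ] ZMod 2) :=
  nonempty_torsion_equiv_zmod two_ne_zero quotientSpanEquiv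
end

section
/- The vector e₃ − e₄ = (0,0,1,−1,0,0,0) ∈ ℤ⁷ does not lie in the subgroup generated by the ten vectors v₁,…,v₁₀, but its double 2(e₃ − e₄) = (0,0,2,−2,0,0,0) does lie in that subgroup. -/
/-- Every element of the span of `v₁, …, v₁₀` has even third coordinate. -/
lemma two_dvd_third_coord_of_mem_span_dalawatVectors {x : Fin 7 → ℤ}
    (hx : x ∈ Submodule.span ℤ (Set.range dalawatVectors)) : (2 : ℤ) ∣ x 2 := by
  induction hx using Submodule.span_induction with
  | mem x h =>
    obtain ⟨i, rfl⟩ := h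
    revert i
    decide
  | zero => exact dvd_zero 2
  | add x y _ _ hx hy => exact dvd_add hx hy
  | smul a x _ hx => exact hx.mul_left a

/-- The vector `e₃ − e₄ = (0,0,1,−1,0,0,0) ∈ ℤ⁷` does not lie in the subgroup generated
by the ten vectors `v₁, …, v₁₀`, but its double `2(e₃ − e₄) = (0,0,2,−2,0,0,0)` does. -/
theorem e3_sub_e4_torsion_of_order_two :
    (![0, 0, 1, -1, 0, 0, 0] : Fin 7 → ℤ) ∉
        Submodule.span ℤ (Set.range dalawatVectors) ∧
    (![0, 0, 2, -2, 0, 0, 0] : Fin 7 → ℤ) ∈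
        Submodule.span ℤ (Set.range dalawatVectors) := by
  constructor
  · intro h
    exact absurd (two_dvd_third_coord_of_mem_span_dalawatVectors h) (by decide)
  · have hv (i : Fin 10) : dalawatVectors i ∈ Submodule.span ℤ (Set.range dalawatVectors) :=
      Submodule.subset_span ⟨i, rfl⟩
    have h : (![0, 0, 2, -2, 0, 0, 0] : Fin 7 → ℤ) =
        dalawatVectors 4 - dalawatVectors 9 + (dalawatVectors 1 - dalawatVectors 6) := by
      decide
    rw [h]
    exact add_mem (sub_mem (hv 4) (hv 9)) (sub_mem (hv 1) (hv 6))
end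

section
/- Let 𝔬 be a commutative ring and let π, d, β ∈ 𝔬. In the quotient ring A = 𝔬[r, t, u, w, R, T]/(f₁, g₁, g₂), where f₁ = π·(d·r² − 1) − β·(t − u)·(t + w), g₁ = π·R − r and g₂ = π·T − t, the image of π lies in I², where I is the ideal of A generated by the images of π, u and w. -/
/-- If `π (d r² - 1) = β (t - u) (t + w)` with `r` and `t` multiples of `π`, then `π` lies in the
square of every ideal containing `π`, `u` and `w`. -/
theorem Ideal.mem_sq_of_mul_sub_one_eq {A : Type*} [CommRing A] {I : Ideal A}
    {π d β r t u w R T : A} (hf : π * (d * r ^ 2 - 1) - β * (t - u) * (t + w) = 0)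
    (hr : π * R - r = 0) (ht : π * T - t = 0) (hπ : π ∈ I) (hu : u ∈ I) (hw : w ∈ I) :
    π ∈ I ^ 2 := by
  obtain rfl := sub_eq_zero.mp hr
  obtain rfl := sub_eq_zero.mp ht
  have key : π = d * π * R ^ 2 * (π * π) - β * ((π * T - u) * (π * T + w)) := by
    linear_combination -hf
  have hT : π * T ∈ I := I.mul_mem_right T hπ
  rw [key, sq I]
  exact sub_mem (Ideal.mul_mem_left _ _ (Ideal.mul_mem_mul hπ hπ))
    (Ideal.mul_mem_left _ _ (Ideal.mul_mem_mul (sub_mem hT hu) (add_mem hT hw)))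

open MvPolynomial in
/-- In the quotient ring `A = 𝔬[r, t, u, w, R, T]/(f₁, g₁, g₂)`, where
`f₁ = π·(d·r² − 1) − β·(t − u)·(t + w)`, `g₁ = π·R − r` and `g₂ = π·T − t`
(the variables `r, t, u, w, R, T` being `X 0, …, X 5`), the image of `π` lies in `I²`,
where `I` is the ideal of `A` generated by the images of `π`, `u` and `w`. -/
theorem pi_mem_sq_of_ideal_pi_u_w (𝔬 : Type*) [CommRing 𝔬] (π d β : 𝔬)
    (J : Ideal (MvPolynomial (Fin 6) 𝔬))
    (hJ : J = Ideal.span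
      {C π * (C d * X 0 ^ 2 - 1) - C β * (X 1 - X 2) * (X 1 + X 3),
       C π * X 4 - X 0,
       C π * X 5 - X 1})
    (I : Ideal (MvPolynomial (Fin 6) 𝔬 ⧸ J))
    (hI : I = Ideal.span
      {Ideal.Quotient.mk J (C π), Ideal.Quotient.mk J (X 2), Ideal.Quotient.mk J (X 3)}) :
    Ideal.Quotient.mk J (C π) ∈ I ^ 2 := by
  have hgen : ∀ x ∈ ({C π * (C d * X 0 ^ 2 - 1) - C β * (X 1 - X 2) * (X 1 + X 3),
      C π * X 4 - X 0, C π * X 5 - X 1} : Set (MvPolynomial (Fin 6) 𝔬)),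
      Ideal.Quotient.mk J x = 0 := fun x hx =>
    Ideal.Quotient.eq_zero_iff_mem.mpr (hJ ▸ Ideal.subset_span hx)
  simp only [Set.mem_insert_iff, Set.mem_singleton_iff, forall_eq_or_imp, forall_eq, map_sub,
    map_add, map_mul, map_pow, map_one] at hgen
  obtain ⟨hf, hr, ht⟩ := hgen
  refine Ideal.mem_sq_of_mul_sub_one_eq hf hr ht ?_ ?_ ?_ <;>
    exact hI ▸ Ideal.subset_span (by simp)
end

section
/- Let 𝔬 be a commutative ring and let π, d ∈ 𝔬. In the polynomial ring 𝔬[P, r, s, t, u, V, U, Z, T], the element π·T·U²·(d·r² − s²) − V·Z·(t − u)² lies in the ideal generated by the three elements π·T − t·P, U·t·(d·r² − s²) − Z·(t − u), and V·(t − u) − P·U. -/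
open MvPolynomial in
/-- In the polynomial ring `𝔬[P, r, s, t, u, V, U, W, Z, T]` (the variables
`P, r, s, t, u, V, U, Z, T` being `X 0, …, X 8`), the element
`π·T·U²·(d·r² − s²) − V·Z·(t − u)²` lies in the ideal generated by
`π·T − t·P`, `U·t·(d·r² − s²) − Z·(t − u)` and `V·(t − u) − P·U`. -/
theorem multiplicity_two_relation (𝔬 : Type*) [CommRing 𝔬] (π d : 𝔬) :
    C π * X 8 * X 6 ^ 2 * (C d * X 1 ^ 2 - X 2 ^ 2) - X 5 * X 7 * (X 3 - X 4) ^ 2 ∈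
      Ideal.span ({C π * X 8 - X 3 * X 0,
                   X 6 * X 3 * (C d * X 1 ^ 2 - X 2 ^ 2) - X 7 * (X 3 - X 4),
                   X 5 * (X 3 - X 4) - X 0 * X 6} : Set (MvPolynomial (Fin 9) 𝔬)) := by
  refine Ideal.mem_span_insert.mpr ⟨X 6 ^ 2 * (C d * X 1 ^ 2 - X 2 ^ 2), _,
    Ideal.mem_span_pair.mpr ⟨X 0 * X 6, -(X 7 * (X 3 - X 4)), rfl⟩, ?_⟩
  ring
end
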